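/- (Niederreiter's identity.) For any integer T ≥ 1 and any coprime integers a, b with 0 ≤ a < b, #(𝓕(T) ∩ [1 − a²/b², 1]) − (a²/b²)·F(T) = − ∑_{n=1}^{T} ∑_{d ∣ n} μ(n/d)·{d·a²/b²}, where {α} denotes the fractional part of α and μ is the Möbius function. -/

import Mathlib

/-- The set of Farey fractions of order `T`: rationals `a/b` with
`0 ≤ a < b ≤ T` and `gcd(a,b) = 1`, viewed as a finite set of rationals in `[0,1)`. -/
def farey (T : ℕ) : Finset ℚ :=
  (((Finset.range (T + 1)) ×ˢ (Finset.range (T + 1))).filter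
    (fun p => p.1 < p.2 ∧ Nat.gcd p.1 p.2 = 1)).image (fun p => (p.1 : ℚ) / (p.2 : ℚ))

/-- `F(T)` is the number of Farey fractions of order `T`. -/
def F (T : ℕ) : ℕ := (farey T).card

/-- The Farey fractions of order `T` lying in `[0, 1/2]`. -/
def fareyHalf (T : ℕ) : Finset ℚ := (farey T).filter (fun q => q ≤ 1 / 2)

/-- `C(T) = ∑_{a/b ∈ 𝓕(T) ∩ [0,1/2]} #(𝓕(T) ∩ [1 - a²/b², 1])`, where a Farey fraction
`q = a/b` in lowest terms satisfies `a²/b² = q²`. -/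
def C (T : ℕ) : ℕ :=
  ∑ q ∈ fareyHalf T, ((farey T).filter (fun ξ => 1 - q ^ 2 ≤ ξ ∧ ξ ≤ 1)).card

/-- `G(T) = ∑_{ξ ∈ 𝓕(T), ξ ≤ 1/2} ξ²`. -/
noncomputable def G (T : ℕ) : ℝ := ∑ q ∈ fareyHalf T, (q : ℝ) ^ 2

/-- The Mertens function `M(n) = ∑_{1 ≤ k ≤ n} μ(k)`. -/
def mertens (n : ℕ) : ℤ := ∑ k ∈ Finset.Icc 1 n, ArithmeticFunction.moebius k

/-- Number of `1 ≤ k ≤ n` coprime to `n` with `k ≤ n x`. -/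
def cntA (x : ℚ) (n : ℕ) : ℕ :=
  ((Finset.Icc 1 n).filter (fun k : ℕ => Nat.Coprime k n ∧ (k : ℚ) ≤ n * x)).card

theorem card_S (x : ℚ) (hx0 : 0 ≤ x) (hx1 : x ≤ 1) (n : ℕ) :
    ((Finset.Icc 1 n).filter (fun k : ℕ => (k : ℚ) ≤ n * x)).card = ⌊(n : ℚ) * x⌋₊ := by
  have h : (Finset.Icc 1 n).filter (fun k : ℕ => (k : ℚ) ≤ n * x)
      = Finset.Icc 1 ⌊(n : ℚ) * x⌋₊ := by
    ext k
    have hnn : (0 : ℚ) ≤ n * x := by positivity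
    simp only [Finset.mem_filter, Finset.mem_Icc, Nat.le_floor_iff hnn]
    constructor
    · rintro ⟨⟨h1, _⟩, h3⟩
      exact ⟨h1, h3⟩
    · rintro ⟨h1, h3⟩
      refine ⟨⟨h1, ?_⟩, h3⟩
      have : (k : ℚ) ≤ n := h3.trans (mul_le_of_le_one_right (by positivity) hx1)
      exact_mod_cast this
  rw [h]; simp

theorem sum_cntA (x : ℚ) (hx0 : 0 ≤ x) (hx1 : x ≤ 1) (n : ℕ) (hn : 0 < n) :
    ∑ e ∈ n.divisors, cntA x e = ⌊(n : ℚ) * x⌋₊ := by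
  rw [← card_S x hx0 hx1 n]
  rw [Finset.card_eq_sum_card_fiberwise (f := fun k => n / Nat.gcd k n) (t := n.divisors)]
  · refine Finset.sum_congr rfl fun e he => ?_
    obtain ⟨c, rfl⟩ := (Nat.mem_divisors.1 he).1
    have he0 : 0 < e := Nat.pos_of_mul_pos_right hn
    have hc0 : 0 < c := Nat.pos_of_mul_pos_left hn
    have hcq : (0 : ℚ) < c := by exact_mod_cast hc0
    unfold cntA
    refine Finset.card_bij (fun k _ => k * c) ?_ ?_ ?_
    · intro k hk
      simp only [Finset.mem_filter, Finset.mem_Icc] at hk ⊢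
      obtain ⟨⟨h1, h2⟩, h3, h4⟩ := hk
      refine ⟨⟨⟨Nat.mul_pos h1 hc0, Nat.mul_le_mul_right _ h2⟩, ?_⟩, ?_⟩
      · push_cast
        nlinarith
      · rw [Nat.gcd_mul_right, Nat.Coprime.gcd_eq_one h3, one_mul, Nat.mul_div_cancel _ hc0]
    · intro k _ l _ h
      exact Nat.eq_of_mul_eq_mul_right hc0 h
    · intro k hk
      simp only [Finset.mem_filter, Finset.mem_Icc] at hk
      obtain ⟨⟨⟨h1, h2⟩, h3⟩, h4⟩ := hk
      have hg : Nat.gcd k (e * c) = c := by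
        have hd := Nat.gcd_dvd_right k (e * c)
        have := Nat.div_mul_cancel hd
        rw [h4] at this
        exact Nat.eq_of_mul_eq_mul_left he0 this
      have hck : c ∣ k := by
        rw [← hg]; exact Nat.gcd_dvd_left _ _
      obtain ⟨m, rfl⟩ := hck
      refine ⟨m, ?_, Nat.mul_comm _ _⟩
      simp only [Finset.mem_filter, Finset.mem_Icc]
      refine ⟨⟨Nat.pos_of_mul_pos_left h1, ?_⟩, ?_, ?_⟩
      · rw [Nat.mul_comm] at h2
        exact Nat.le_of_mul_le_mul_right h2 hc0
      · rw [Nat.mul_comm c m, Nat.gcd_mul_right] at hg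
        exact Nat.eq_of_mul_eq_mul_right hc0 (by rw [hg, one_mul])
      · push_cast at h3
        have : (c : ℚ) * m ≤ c * (e * x) := by linarith
        exact le_of_mul_le_mul_left this hcq
  · intro k _
    simp only [Finset.mem_coe, Nat.mem_divisors]
    exact ⟨Nat.div_dvd_of_dvd (Nat.gcd_dvd_right _ _), hn.ne'⟩

theorem cntA_eq (x : ℚ) (hx0 : 0 ≤ x) (hx1 : x ≤ 1) (n : ℕ) (hn : 0 < n) :
    (cntA x n : ℝ) = ∑ d ∈ n.divisors,
      (ArithmeticFunction.moebius (n / d) : ℝ) * (⌊(d : ℚ) * x⌋₊ : ℝ) := by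
  have h := (ArithmeticFunction.sum_eq_iff_sum_mul_moebius_eq (R := ℝ)
    (f := fun n => (cntA x n : ℝ)) (g := fun n => (⌊(n : ℚ) * x⌋₊ : ℝ))).1
    (fun n hn => by
      have := sum_cntA x hx0 hx1 n hn
      exact_mod_cast this) n hn
  rw [← h, Nat.sum_divisorsAntidiagonal'
    (f := fun i j => (ArithmeticFunction.moebius i : ℝ) * (⌊(j : ℚ) * x⌋₊ : ℝ))]

theorem den_aux (i j : ℕ) (hj : 0 < j) (h : Nat.Coprime i j) : ((i : ℚ) / (j : ℚ)).den = j := by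
  have := Rat.den_div_eq_of_coprime (a := (i : ℤ)) (b := (j : ℤ))
    (by omega) (by simpa using h)
  rw [Int.cast_natCast, Int.cast_natCast] at this
  omega

theorem num_lt_den_aux (q : ℚ) (h : q < 1) : q.num < q.den := by
  have h1 := Rat.mul_den_eq_num q
  have h2 : (0 : ℚ) < q.den := by exact_mod_cast q.den_pos
  have h3 : (q.num : ℚ) < q.den := by nlinarith
  exact_mod_cast h3

theorem mem_farey (T : ℕ) (q : ℚ) : q ∈ farey T ↔ 0 ≤ q ∧ q < 1 ∧ q.den ≤ T := by
  unfold farey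
  simp only [Finset.mem_image, Finset.mem_filter, Finset.mem_product, Finset.mem_range,
    Prod.exists]
  constructor
  · rintro ⟨i, j, ⟨⟨h1, h2⟩, h3, h4⟩, rfl⟩
    have hj : (0 : ℚ) < j := by exact_mod_cast (by omega : 0 < j)
    refine ⟨by positivity, ?_, ?_⟩
    · rw [div_lt_one hj]; exact_mod_cast h3
    · have : ((i : ℚ) / j).den = j := by
        exact den_aux i j (by omega) h4
      omega
  · rintro ⟨h0, h1, h2⟩
    have hnum : 0 ≤ q.num := Rat.num_nonneg.2 h0
    have hlt : q.num < q.den := num_lt_den_aux q h1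
    refine ⟨q.num.natAbs, q.den, ⟨⟨by omega, by omega⟩, by omega, q.reduced⟩, ?_⟩
    have : ((q.num.natAbs : ℕ) : ℚ) = q.num := by
      rw [Nat.cast_natAbs, abs_of_nonneg hnum]
    rw [this, Rat.num_div_den]

theorem card_farey (T : ℕ) (x : ℚ) :
    ((farey T).filter (fun ξ => 1 - x ≤ ξ ∧ ξ ≤ 1)).card
      = ∑ n ∈ Finset.Icc 1 T, cntA x n := by
  rw [Finset.card_eq_sum_card_fiberwise (f := fun q : ℚ => q.den) (t := Finset.Icc 1 T)]
  · refine Finset.sum_congr rfl fun n hn => ?_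
    rw [Finset.mem_Icc] at hn
    have hn0 : (0 : ℚ) < n := by exact_mod_cast hn.1
    symm
    unfold cntA
    refine Finset.card_bij (fun k _ => ((n - k : ℕ) : ℚ) / n) ?_ ?_ ?_
    · intro k hk
      simp only [Finset.mem_filter, Finset.mem_Icc, mem_farey] at hk ⊢
      obtain ⟨⟨h1, h2⟩, h3, h4⟩ := hk
      have hden : (((n - k : ℕ) : ℚ) / n).den = n := by
        exact den_aux (n - k) n hn.1 ((Nat.coprime_self_sub_left h2).2 h3)
      have hk1 : (1 : ℚ) ≤ k := by exact_mod_cast h1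
      have hlt : ((n - k : ℕ) : ℚ) / n < 1 := by
        rw [div_lt_one hn0, Nat.cast_sub h2]; linarith
      refine ⟨⟨⟨by positivity, hlt, by rw [hden]; exact hn.2⟩, ?_, hlt.le⟩, hden⟩
      rw [le_div_iff₀ hn0, Nat.cast_sub h2]
      linarith
    · intro k hk l hl h
      simp only [Finset.mem_filter, Finset.mem_Icc] at hk hl
      rw [div_left_inj' hn0.ne'] at h
      have : n - k = n - l := by exact_mod_cast h
      omega
    · intro q hq
      simp only [Finset.mem_filter, mem_farey] at hq
      obtain ⟨⟨⟨h0, h1, h2⟩, h3, _⟩, rfl⟩ := hq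
      have hnum : 0 ≤ q.num := Rat.num_nonneg.2 h0
      have hlt : q.num < q.den := num_lt_den_aux q h1
      have hnat : ((q.num.natAbs : ℕ) : ℚ) = q.num := by
        rw [Nat.cast_natAbs, abs_of_nonneg hnum]
      have hle : q.num.natAbs ≤ q.den := by omega
      refine ⟨q.den - q.num.natAbs, ?_, ?_⟩
      · simp only [Finset.mem_filter, Finset.mem_Icc]
        refine ⟨by omega, (Nat.coprime_self_sub_left hle).2 q.reduced, ?_⟩
        rw [Nat.cast_sub hle, hnat]
        have := Rat.mul_den_eq_num q
        nlinarith
      · rw [Nat.sub_sub_self hle, hnat, Rat.num_div_den]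
  · intro q hq
    simp only [Finset.coe_filter, Set.mem_ofPred_eq, mem_farey] at hq
    simp only [Finset.coe_Icc, Set.mem_Icc]
    exact ⟨q.den_pos, hq.1.2.2⟩

theorem F_eq (T : ℕ) : (F T : ℝ) = ∑ n ∈ Finset.Icc 1 T, ∑ d ∈ n.divisors,
      (ArithmeticFunction.moebius (n / d) : ℝ) * (d : ℝ) := by
  have h : F T = ∑ n ∈ Finset.Icc 1 T, cntA 1 n := by
    rw [← card_farey, F, Finset.filter_true_of_mem]
    intro q hq
    rw [mem_farey] at hq
    exact ⟨by linarith [hq.1], hq.2.1.le⟩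
  rw [h, Nat.cast_sum]
  refine Finset.sum_congr rfl fun n hn => ?_
  rw [cntA_eq 1 zero_le_one le_rfl n (Finset.mem_Icc.1 hn).1]
  simp

/-- Niederreiter's identity: for coprime integers `0 ≤ a < b` and `T ≥ 1`,
`#(𝓕(T) ∩ [1 - a²/b², 1]) - (a²/b²)·F(T) = -∑_{n=1}^{T} ∑_{d ∣ n} μ(n/d)·{d·a²/b²}`. -/
theorem niederreiter_identity (T a b : ℕ) (hT : 1 ≤ T) (hab : a < b)
    (hcop : Nat.gcd a b = 1) :
    ((((farey T).filter
        (fun ξ => 1 - (a : ℚ) ^ 2 / (b : ℚ) ^ 2 ≤ ξ ∧ ξ ≤ 1)).card : ℝ)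
      - (a : ℝ) ^ 2 / (b : ℝ) ^ 2 * (F T : ℝ))
    = - ∑ n ∈ Finset.Icc 1 T, ∑ d ∈ n.divisors,
        (ArithmeticFunction.moebius (n / d) : ℝ)
          * Int.fract ((d : ℝ) * (a : ℝ) ^ 2 / (b : ℝ) ^ 2) := by
  have hb : (0 : ℚ) < b := by exact_mod_cast (by omega : 0 < b)
  have habq : (a : ℚ) ≤ b := by exact_mod_cast hab.le
  have hx0 : (0 : ℚ) ≤ (a : ℚ) ^ 2 / (b : ℚ) ^ 2 := by positivity
  have hx1 : (a : ℚ) ^ 2 / (b : ℚ) ^ 2 ≤ 1 := by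
    rw [div_le_one (by positivity)]
    gcongr
  rw [card_farey, F_eq, Nat.cast_sum, Finset.mul_sum, ← Finset.sum_sub_distrib,
    ← Finset.sum_neg_distrib]
  refine Finset.sum_congr rfl fun n hn => ?_
  rw [cntA_eq _ hx0 hx1 n (Finset.mem_Icc.1 hn).1, Finset.mul_sum, ← Finset.sum_sub_distrib,
    ← Finset.sum_neg_distrib]
  refine Finset.sum_congr rfl fun d _ => ?_
  have hfl : ((⌊(d : ℚ) * ((a : ℚ) ^ 2 / (b : ℚ) ^ 2)⌋₊ : ℕ) : ℝ)
      = (⌊(d : ℝ) * (a : ℝ) ^ 2 / (b : ℝ) ^ 2⌋ : ℝ) := by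
    have h1 : ((d : ℝ) * (a : ℝ) ^ 2 / (b : ℝ) ^ 2)
        = (((d : ℚ) * ((a : ℚ) ^ 2 / (b : ℚ) ^ 2) : ℚ) : ℝ) := by
      push_cast; ring
    rw [h1, Rat.floor_cast, ← Int.natCast_floor_eq_floor (by positivity)]
    simp
  rw [hfl, Int.fract]
  ring
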